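/- For complex ν with Re ν > -1: ∫_{-1}^1 [P_ν(x)]³ (1-x²)^{(ν-1)/2} dx = 2 ∫_{-1}^1 P_ν(x) [P_{ν+1}(x)]² (1-x²)^{(ν-1)/2} dx. -/

import Mathlib

open Real MeasureTheory intervalIntegral Complex

/-- Complete elliptic integral of the first kind. -/
noncomputable def ellipticK (k : ℝ) : ℝ :=
  ∫ θ in (0:ℝ)..(π/2), (1 - k ^ 2 * Real.sin θ ^ 2) ^ (-(1/2 : ℝ))

/-- Complete elliptic integral of the second kind. -/
noncomputable def ellipticE (k : ℝ) : ℝ :=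
  ∫ θ in (0:ℝ)..(π/2), (1 - k ^ 2 * Real.sin θ ^ 2) ^ ((1/2 : ℝ))

/-- Legendre function of the first kind of degree ν : P_ν(1-2z) = ₂F₁(-ν, ν+1; 1; z). -/
noncomputable def legendreP (ν : ℂ) (x : ℂ) : ℂ :=
  ordinaryHypergeometric (-ν) (ν + 1) 1 ((1 - x) / 2)

noncomputable def lc (ν : ℂ) (n : ℕ) : ℂ :=
  ((Nat.factorial n : ℂ)⁻¹) * (ascPochhammer ℂ n).eval (-ν) * (ascPochhammer ℂ n).eval (ν + 1) *
    ((ascPochhammer ℂ n).eval 1)⁻¹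

noncomputable def lF (ν z : ℂ) : ℂ := ∑' n : ℕ, lc ν n * z ^ n

lemma legendreP_eq (ν x : ℂ) : legendreP ν x = lF ν ((1 - x) / 2) := by
  rw [legendreP, ordinaryHypergeometric_eq_tsum]
  simp [lF, lc]

lemma lc_zero (ν : ℂ) : lc ν 0 = 1 := by simp [lc]

lemma lc_succ (ν : ℂ) (n : ℕ) :
    lc ν (n + 1) * ((n : ℂ) + 1) ^ 2 = lc ν n * (n * (n + 1) - ν * (ν + 1)) := by
  have h : (n : ℂ) + 1 ≠ 0 := Nat.cast_add_one_ne_zero n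
  have h2 : (Nat.factorial n : ℂ) ≠ 0 := by exact_mod_cast Nat.factorial_ne_zero n
  simp only [lc, ascPochhammer_succ_eval, ascPochhammer_eval_one, Nat.factorial_succ]
  push_cast
  have h3 : (1 : ℂ) + n ≠ 0 := by rwa [add_comm]
  field_simp
  ring

lemma lc_pair (ν : ℂ) (m : ℕ) : ∃ E : ℂ, lc ν (m + 1) = (m - ν) * E ∧
    lc (ν + 1) (m + 1) = -(ν + 2 + m) * E := by
  have h1 : ∀ a : ℂ, (ascPochhammer ℂ (m + 1)).eval a
      = a * (ascPochhammer ℂ m).eval (a + 1) := by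
    intro a
    rw [ascPochhammer_succ_left]
    simp [Polynomial.eval_comp]
  refine ⟨((Nat.factorial (m + 1) : ℂ)⁻¹) * ((ascPochhammer ℂ (m + 1)).eval 1)⁻¹ * (ν + 1) *
    (ascPochhammer ℂ m).eval (-ν) * (ascPochhammer ℂ m).eval (ν + 2), ?_, ?_⟩
  · rw [lc, ascPochhammer_succ_eval m (-ν), h1 (ν + 1), show ν + 1 + 1 = ν + 2 by ring]
    ring
  · rw [lc, h1 (-(ν + 1)), ascPochhammer_succ_eval m (ν + 1 + 1), show ν + 1 + 1 = ν + 2 by ring,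
      show -(ν + 1) + 1 = -ν by ring]
    ring

lemma lc_bound (ν : ℂ) : ∃ C : ℝ, 1 ≤ C ∧ ∀ n : ℕ, ‖lc ν (n + 1)‖ ≤ C / (n + 1) := by
  set M : ℝ := ‖ν * (ν + 1)‖ with hM
  have hM0 : 0 ≤ M := norm_nonneg _
  have key : ∀ n : ℕ, ((n : ℝ) + 1) * ‖lc ν (n + 1)‖
      ≤ ‖lc ν 1‖ * Real.exp (M - M / (n + 1)) := by
    intro n
    induction n with
    | zero => simp
    | succ n ih =>
      have h := congrArg norm (lc_succ ν (n + 1))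
      rw [norm_mul, norm_mul, norm_pow] at h
      have e1 : ‖((n + 1 : ℕ) : ℂ) + 1‖ = (n : ℝ) + 2 := by
        rw [← Nat.cast_add_one, Complex.norm_natCast]; push_cast; ring
      have e2 : ‖((n + 1 : ℕ) : ℂ) * (((n + 1 : ℕ) : ℂ) + 1) - ν * (ν + 1)‖
          ≤ ((n : ℝ) + 1) * (n + 2) + M := by
        refine (norm_sub_le _ _).trans ?_
        rw [norm_mul, e1, Complex.norm_natCast]; push_cast; rfl
      rw [e1] at h
      have p1 : (0 : ℝ) < (n : ℝ) + 1 := by positivity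
      have p2 : (0 : ℝ) < (n : ℝ) + 2 := by positivity
      have h2 : ((n : ℝ) + 2) * ‖lc ν (n + 1 + 1)‖ ≤
          (((n : ℝ) + 1) * ‖lc ν (n + 1)‖) * (M / ((n + 1) * (n + 2)) + 1) := by
        have : ‖lc ν (n + 1 + 1)‖ * ((n : ℝ) + 2) ^ 2 ≤
            ‖lc ν (n + 1)‖ * (((n : ℝ) + 1) * (n + 2) + M) := by
          rw [h]; gcongr
        have e3 : (((n : ℝ) + 1) * ‖lc ν (n + 1)‖) * (M / ((n + 1) * (n + 2)) + 1)
          = (‖lc ν (n + 1)‖ * (((n : ℝ) + 1) * (n + 2) + M)) / (n + 2) := by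
          field_simp; ring
        rw [e3, le_div_iff₀ p2]
        linarith
      push_cast
      calc ((n : ℝ) + 1 + 1) * ‖lc ν (n + 1 + 1)‖
          = ((n : ℝ) + 2) * ‖lc ν (n + 1 + 1)‖ := by ring
        _ ≤ _ := h2
        _ ≤ (‖lc ν 1‖ * Real.exp (M - M / (n + 1))) * Real.exp (M / ((n + 1) * (n + 2))) := by
          gcongr
          exact Real.add_one_le_exp _
        _ = _ := by
          rw [mul_assoc, ← Real.exp_add]
          congr 2
          field_simp
          ring
  refine ⟨max 1 (‖lc ν 1‖ * Real.exp M), le_max_left _ _, fun n => ?_⟩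
  have p1 : (0 : ℝ) < (n : ℝ) + 1 := by positivity
  rw [le_div_iff₀ p1, mul_comm]
  refine (key n).trans (le_trans ?_ (le_max_right _ _))
  gcongr
  have : 0 ≤ M / ((n : ℝ) + 1) := by positivity
  linarith

lemma lc_bdd (ν : ℂ) : ∃ C : ℝ, 1 ≤ C ∧ ∀ n : ℕ, ‖lc ν n‖ ≤ C := by
  obtain ⟨C, hC, h⟩ := lc_bound ν
  refine ⟨C, hC, fun n => ?_⟩
  cases n with
  | zero => simpa [lc_zero] using hC
  | succ n =>
    refine (h n).trans (div_le_self (by linarith) ?_)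
    have : (0 : ℝ) ≤ n := n.cast_nonneg
    linarith

lemma summ_pow (k : ℕ) (c : ℕ → ℂ) (C : ℝ) (hc : ∀ n, ‖c n‖ ≤ C) (z : ℂ) (hz : ‖z‖ < 1) :
    Summable (fun n : ℕ => (n : ℂ) ^ k * c n * z ^ n) := by
  have h := (summable_pow_mul_geometric_of_norm_lt_one k (r := ‖z‖) (by simpa using hz)).mul_left C
  refine Summable.of_norm_bounded h fun n => ?_
  rw [norm_mul, norm_mul, norm_pow, norm_pow, Complex.norm_natCast]
  have := mul_le_mul_of_nonneg_right (hc n) (by positivity : 0 ≤ (n : ℝ) ^ k * ‖z‖ ^ n)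
  linarith

lemma lF_hasDerivAt (ν z : ℂ) (hz : ‖z‖ < 1) :
    HasDerivAt (lF ν) (∑' n : ℕ, lc ν n * (n * z ^ (n - 1))) z := by
  obtain ⟨C, hC, hc⟩ := lc_bdd ν
  obtain ⟨r, hr1, hr2⟩ := exists_between hz
  have hr0 : 0 ≤ r := (norm_nonneg z).trans hr1.le
  have hu : Summable (fun n : ℕ => C * (n * r ^ (n - 1))) := by
    apply Summable.mul_left
    rw [← summable_nat_add_iff 1]
    have h1 := summable_pow_mul_geometric_of_norm_lt_one 1 (r := r)
      (by rwa [Real.norm_of_nonneg hr0])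
    have h0 := summable_pow_mul_geometric_of_norm_lt_one 0 (r := r)
      (by rwa [Real.norm_of_nonneg hr0])
    refine (h1.add h0).congr fun n => ?_
    simp; ring
  refine hasDerivAt_tsum_of_isPreconnected (t := Metric.ball (0 : ℂ) r) (y₀ := 0)
    (g := fun n z => lc ν n * z ^ n) (g' := fun n z => lc ν n * (n * z ^ (n - 1)))
    hu Metric.isOpen_ball (convex_ball _ _).isPreconnected ?_ ?_ ?_ ?_ ?_
  · intro n y _
    exact (hasDerivAt_pow n y).const_mul _
  · intro n y hy
    rw [mem_ball_zero_iff] at hy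
    rw [norm_mul, norm_mul, norm_pow, Complex.norm_natCast]
    gcongr
    exact hc n
  · exact Metric.mem_ball_self ((norm_nonneg z).trans_lt hr1)
  · simpa using summ_pow 0 (lc ν) C hc 0 (by simp)
  · simpa using hr1

lemma series_aux (z : ℂ) (u v : ℕ → ℂ) (hu : Summable fun n => u n * z ^ n)
    (h0 : u 0 = 0) (h : ∀ n, u (n + 1) = v n) :
    ∑' n, u n * z ^ n = z * ∑' n, v n * z ^ n := by
  rw [hu.tsum_eq_zero_add, h0, ← tsum_mul_left]
  simp only [zero_mul, zero_add, h]
  exact tsum_congr fun n => by ring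

lemma lF_deriv_eqs (ν z : ℂ) (hz : ‖z‖ < 1) : ∃ D D' : ℂ, HasDerivAt (lF ν) D z ∧
    HasDerivAt (lF (ν + 1)) D' z ∧
    -2 * z * (1 - z) * D = (ν + 1) * ((1 - 2 * z) * lF ν z - lF (ν + 1) z) ∧
    -2 * z * (1 - z) * D' = (ν + 1) * (lF ν z - (1 - 2 * z) * lF (ν + 1) z) := by
  refine ⟨_, _, lF_hasDerivAt ν z hz, lF_hasDerivAt (ν + 1) z hz, ?_, ?_⟩
  all_goals
    obtain ⟨C, -, hc⟩ := lc_bdd ν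
    obtain ⟨C', -, hd⟩ := lc_bdd (ν + 1)
    have sc0 : Summable fun n => lc ν n * z ^ n := by simpa using summ_pow 0 _ C hc z hz
    have sd0 : Summable fun n => lc (ν + 1) n * z ^ n := by simpa using summ_pow 0 _ C' hd z hz
    have sc1 : Summable fun n : ℕ => (n : ℂ) * lc ν n * z ^ n := by
      simpa using summ_pow 1 _ C hc z hz
    have sd1 : Summable fun n : ℕ => (n : ℂ) * lc (ν + 1) n * z ^ n := by
      simpa using summ_pow 1 _ C' hd z hz
    have eD : ∀ μ : ℂ, z * (∑' n : ℕ, lc μ n * (n * z ^ (n - 1)))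
        = ∑' n : ℕ, (n : ℂ) * lc μ n * z ^ n := by
      intro μ
      rw [← tsum_mul_left]
      refine tsum_congr fun n => ?_
      cases n with
      | zero => simp
      | succ n => simp; ring
  · have A := series_aux z (fun n => (2 * n + (ν + 1)) * lc ν n - (ν + 1) * lc (ν + 1) n)
      (fun n => 2 * (n + (ν + 1)) * lc ν n) ?_ ?_ ?_
    · have e1 : ∑' n : ℕ, ((2 * n + (ν + 1)) * lc ν n - (ν + 1) * lc (ν + 1) n) * z ^ n
          = 2 * ∑' n : ℕ, (n : ℂ) * lc ν n * z ^ n + (ν + 1) * lF ν z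
            - (ν + 1) * lF (ν + 1) z := by
        rw [lF, lF, ← tsum_mul_left, ← tsum_mul_left, ← tsum_mul_left,
          ← (sc1.mul_left 2).tsum_add (sc0.mul_left _),
          ← ((sc1.mul_left 2).add (sc0.mul_left _)).tsum_sub (sd0.mul_left _)]
        exact tsum_congr fun n => by ring
      have e2 : ∑' n : ℕ, (2 * (n + (ν + 1)) * lc ν n) * z ^ n
          = 2 * ∑' n : ℕ, (n : ℂ) * lc ν n * z ^ n + 2 * (ν + 1) * lF ν z := by
        rw [lF, ← tsum_mul_left, ← tsum_mul_left,
          ← (sc1.mul_left 2).tsum_add (sc0.mul_left _)]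
        exact tsum_congr fun n => by ring
      rw [e1, e2, ← eD] at A
      linear_combination (-1 : ℂ) * A
    · refine (((sc1.mul_left 2).add (sc0.mul_left (ν + 1))).sub
        (sd0.mul_left (ν + 1))).congr fun n => by ring
    · simp [lc_zero]
    · intro n
      cases n with
      | zero =>
        obtain ⟨E, h1, h2⟩ := lc_pair ν 0
        have h3 := lc_succ ν 0
        simp [lc_zero] at h1 h2 h3 ⊢
        have h4 : ν * E = ν * (ν + 1) := by linear_combination -h3 + h1
        have h5 := lc_succ (ν + 1) 0
        simp [lc_zero] at h5
        rw [h3, h5]; ring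
      | succ n =>
        obtain ⟨E, h1, h2⟩ := lc_pair ν n
        have h3 := lc_succ ν (n + 1)
        have h4 := lc_succ (ν + 1) (n + 1)
        rw [h1] at h3
        rw [h2] at h4
        have hn : (n : ℂ) + 2 ≠ 0 := by exact_mod_cast (Nat.succ_ne_zero (n + 1))
        simp only [h1]
        push_cast at *
        refine mul_right_cancel₀ (pow_ne_zero 2 hn) ?_
        linear_combination (2 * (n + 2) + (ν + 1)) * h3 - (ν + 1) * h4
  · have A := series_aux z (fun n => (2 * n - (ν + 1)) * lc (ν + 1) n + (ν + 1) * lc ν n)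
      (fun n => 2 * (n - (ν + 1)) * lc (ν + 1) n) ?_ ?_ ?_
    · have e1 : ∑' n : ℕ, ((2 * n - (ν + 1)) * lc (ν + 1) n + (ν + 1) * lc ν n) * z ^ n
          = 2 * ∑' n : ℕ, (n : ℂ) * lc (ν + 1) n * z ^ n + (ν + 1) * lF ν z
            - (ν + 1) * lF (ν + 1) z := by
        rw [lF, lF, ← tsum_mul_left, ← tsum_mul_left, ← tsum_mul_left,
          ← (sd1.mul_left 2).tsum_add (sc0.mul_left _),
          ← ((sd1.mul_left 2).add (sc0.mul_left _)).tsum_sub (sd0.mul_left _)]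
        exact tsum_congr fun n => by ring
      have e2 : ∑' n : ℕ, (2 * (n - (ν + 1)) * lc (ν + 1) n) * z ^ n
          = 2 * ∑' n : ℕ, (n : ℂ) * lc (ν + 1) n * z ^ n - 2 * (ν + 1) * lF (ν + 1) z := by
        rw [lF, ← tsum_mul_left, ← tsum_mul_left,
          ← (sd1.mul_left 2).tsum_sub (sd0.mul_left _)]
        exact tsum_congr fun n => by ring
      rw [e1, e2, ← eD] at A
      linear_combination (-1 : ℂ) * A
    · refine (((sd1.mul_left 2).add (sc0.mul_left (ν + 1))).sub
        (sd0.mul_left (ν + 1))).congr fun n => by ring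
    · simp [lc_zero]
    · intro n
      cases n with
      | zero =>
        have h3 := lc_succ ν 0
        have h5 := lc_succ (ν + 1) 0
        simp [lc_zero] at h3 h5 ⊢
        rw [h3, h5]; ring
      | succ n =>
        obtain ⟨E, h1, h2⟩ := lc_pair ν n
        have h3 := lc_succ ν (n + 1)
        have h4 := lc_succ (ν + 1) (n + 1)
        rw [h1] at h3
        rw [h2] at h4
        have hn : (n : ℂ) + 2 ≠ 0 := by exact_mod_cast (Nat.succ_ne_zero (n + 1))
        simp only [h2]
        push_cast at *
        refine mul_right_cancel₀ (pow_ne_zero 2 hn) ?_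
        linear_combination (2 * (n + 2) - (ν + 1)) * h4 + (ν + 1) * h3

lemma lF_log_bound (ν : ℂ) : ∃ C : ℝ, 1 ≤ C ∧ ∀ t : ℝ, 0 ≤ t → t < 1 →
    ‖lF ν (t : ℂ)‖ ≤ 1 + C * (-Real.log (1 - t)) := by
  obtain ⟨C, hC, h⟩ := lc_bound ν
  obtain ⟨C', -, hc⟩ := lc_bdd ν
  refine ⟨C, hC, fun t ht ht1 => ?_⟩
  have hn : ‖(t : ℂ)‖ = t := by simp [abs_of_nonneg ht]
  have s0 : Summable fun n => lc ν n * (t : ℂ) ^ n := by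
    simpa using summ_pow 0 _ C' hc t (by rwa [hn])
  have hs := (Real.hasSum_pow_div_log_of_abs_lt_one (x := t) (by rwa [abs_of_nonneg ht])).mul_left C
  rw [lF, s0.tsum_eq_zero_add]
  refine (norm_add_le _ _).trans ?_
  gcongr
  · simp [lc_zero]
  · refine tsum_of_norm_bounded hs fun n => ?_
    rw [norm_mul, norm_pow, hn]
    calc _ ≤ C / (n + 1) * t ^ (n + 1) := by gcongr; exact h n
      _ = _ := by ring

lemma legendreP_bound (ν : ℂ) (ε : ℝ) (hε : 0 < ε) : ∃ A : ℝ, 0 ≤ A ∧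
    ∀ x : ℝ, -1 < x → x < 1 → ‖legendreP ν (x : ℂ)‖ ≤ A * (1 - x ^ 2) ^ (-ε) := by
  obtain ⟨C, hC, h⟩ := lF_log_bound ν
  have hl4 : 0 ≤ Real.log 4 := Real.log_nonneg (by norm_num)
  refine ⟨1 + C * (Real.log 4 + 1 / ε), by positivity, fun x hx hx1 => ?_⟩
  have h2 := h ((1 - x) / 2) (by linarith) (by linarith)
  rw [legendreP_eq]
  push_cast at h2
  refine h2.trans ?_
  have hs0 : 0 < 1 - x ^ 2 := by nlinarith
  have hs1 : 1 - x ^ 2 ≤ 1 := by nlinarith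
  have hu : 1 ≤ (1 - x ^ 2) ^ (-ε) := Real.one_le_rpow_of_pos_of_le_one_of_nonpos hs0 hs1 (by linarith)
  have hlog : -Real.log (1 - (1 - x) / 2) ≤ Real.log 4 - Real.log (1 - x ^ 2) := by
    have : Real.log ((1 - x ^ 2) / 4) ≤ Real.log (1 - (1 - x) / 2) :=
      Real.log_le_log (by positivity) (by nlinarith)
    rw [Real.log_div hs0.ne' (by norm_num)] at this
    linarith
  have hl : -Real.log (1 - x ^ 2) ≤ (1 - x ^ 2) ^ (-ε) / ε := by
    have := Real.log_le_rpow_div (x := (1 - x ^ 2)⁻¹) (by positivity) hε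
    rwa [Real.log_inv, Real.inv_rpow hs0.le, ← Real.rpow_neg hs0.le] at this
  set u := (1 - x ^ 2) ^ (-ε)
  calc 1 + C * (-Real.log (1 - (1 - x) / 2)) ≤ u + C * (Real.log 4 * u + u / ε) := by
        gcongr
        nlinarith
    _ = _ := by ring

lemma legendreP_deriv (ν : ℂ) (x : ℝ) (hx : -1 < x) (hx1 : x < 1) : ∃ p' q' : ℂ,
    HasDerivAt (fun y : ℝ => legendreP ν (y : ℂ)) p' x ∧
    HasDerivAt (fun y : ℝ => legendreP (ν + 1) (y : ℂ)) q' x ∧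
    (1 - (x : ℂ) ^ 2) * p' = (ν + 1) * (x * legendreP ν x - legendreP (ν + 1) x) ∧
    (1 - (x : ℂ) ^ 2) * q' = (ν + 1) * (legendreP ν x - x * legendreP (ν + 1) x) := by
  have hz : ‖(1 - (x : ℂ)) / 2‖ < 1 := by
    have : (1 - (x : ℂ)) / 2 = (((1 - x) / 2 : ℝ) : ℂ) := by push_cast; ring
    rw [this, Complex.norm_real, Real.norm_of_nonneg (by linarith)]
    linarith
  obtain ⟨D, D', h1, h2, h3, h4⟩ := lF_deriv_eqs ν _ hz
  have hl : HasDerivAt (fun y : ℂ => (1 - y) / 2) (-1 / 2) (x : ℂ) :=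
    ((hasDerivAt_id (x : ℂ)).const_sub 1).div_const 2
  refine ⟨D * (-1 / 2), D' * (-1 / 2), ?_, ?_, ?_, ?_⟩
  · have := (HasDerivAt.comp (x : ℂ) h1 hl).comp_ofReal
    simp only [legendreP_eq]
    exact this
  · have := (HasDerivAt.comp (x : ℂ) h2 hl).comp_ofReal
    simp only [legendreP_eq]
    exact this
  · rw [legendreP_eq, legendreP_eq]
    linear_combination h3
  · rw [legendreP_eq, legendreP_eq]
    linear_combination h4

lemma legendreP_cont (ν : ℂ) :
    ContinuousOn (fun y : ℝ => legendreP ν (y : ℂ)) (Set.Ioo (-1) 1) := by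
  intro x hx
  obtain ⟨p', q', h, -⟩ := legendreP_deriv ν x hx.1 hx.2
  exact h.continuousAt.continuousWithinAt

lemma weight_cont (a : ℂ) :
    ContinuousOn (fun y : ℝ => (1 - (y : ℂ) ^ 2) ^ a) (Set.Ioo (-1) 1) := by
  refine ContinuousOn.cpow_const (by fun_prop) fun x hx => ?_
  have : (1 - (x : ℂ) ^ 2) = ((1 - x ^ 2 : ℝ) : ℂ) := by push_cast; ring
  rw [this]
  exact Complex.ofReal_mem_slitPlane.2 (by nlinarith [hx.1, hx.2])

lemma integrable_of_bound (f : ℝ → ℂ) (hf : ContinuousOn f (Set.Ioo (-1) 1)) (K r : ℝ)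
    (hK : 0 ≤ K) (hr0 : 0 ≤ r) (hr : r < 1)
    (hb : ∀ x : ℝ, -1 < x → x < 1 → ‖f x‖ ≤ K * (1 - x ^ 2) ^ (-r)) :
    IntervalIntegrable f volume (-1) 1 := by
  have i0 : ∀ a b : ℝ, IntervalIntegrable (fun x : ℝ => x ^ (-r)) volume a b :=
    fun a b => intervalIntegrable_rpow' (by linarith)
  have i1 : IntervalIntegrable (fun x : ℝ => (1 - x) ^ (-r)) volume (-1) 1 := by
    have := (i0 2 0).comp_sub_left 1
    norm_num at this
    exact this
  have i2 : IntervalIntegrable (fun x : ℝ => (1 + x) ^ (-r)) volume (-1) 1 := by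
    have := (i0 0 2).comp_add_left 1
    norm_num at this
    exact this
  have i3 := (i1.add i2).const_mul K
  rw [intervalIntegrable_iff_integrableOn_Ioo_of_le (by norm_num)] at i3 ⊢
  refine Integrable.mono' i3 (hf.aestronglyMeasurable measurableSet_Ioo) ?_
  refine (ae_restrict_iff' measurableSet_Ioo).2 (Filter.Eventually.of_forall fun x hx => ?_)
  refine (hb x hx.1 hx.2).trans ?_
  obtain ⟨h1, h2⟩ := hx
  have n1 : 0 ≤ (1 - x) ^ (-r) := Real.rpow_nonneg (by linarith) _
  have n2 : 0 ≤ (1 + x) ^ (-r) := Real.rpow_nonneg (by linarith) _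
  refine mul_le_mul_of_nonneg_left ?_ hK
  rcases le_total 0 x with h | h
  · refine le_trans (Real.rpow_le_rpow_of_nonpos (x := 1 - x) (by linarith) (by nlinarith)
      (by linarith)) (le_add_of_nonneg_right n2)
  · refine le_trans (Real.rpow_le_rpow_of_nonpos (x := 1 + x) (by linarith) (by nlinarith)
      (by linarith)) (le_add_of_nonneg_left n1)

lemma triple_bound (ν a : ℂ) (ε t : ℝ) (hε : 0 < ε) (ht : t ≤ a.re - 3 * ε) :
    ∃ K : ℝ, 0 ≤ K ∧ ∀ x : ℝ, -1 < x → x < 1 →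
      ∀ f₁ ∈ ({legendreP ν x, legendreP (ν + 1) x} : Set ℂ),
      ∀ f₂ ∈ ({legendreP ν x, legendreP (ν + 1) x} : Set ℂ),
      ∀ f₃ ∈ ({legendreP ν x, legendreP (ν + 1) x} : Set ℂ),
      ‖f₁ * f₂ * f₃ * (1 - (x : ℂ) ^ 2) ^ a‖ ≤ K * (1 - x ^ 2) ^ t := by
  obtain ⟨A, hA, h1⟩ := legendreP_bound ν ε hε
  obtain ⟨B, hB, h2⟩ := legendreP_bound (ν + 1) ε hε
  refine ⟨(A + B) ^ 3, by positivity, fun x hx hx1 f₁ hf₁ f₂ hf₂ f₃ hf₃ => ?_⟩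
  have hs0 : 0 < 1 - x ^ 2 := by nlinarith
  have hs1 : 1 - x ^ 2 ≤ 1 := by nlinarith
  have hu : 0 ≤ (1 - x ^ 2) ^ (-ε) := by positivity
  have key : ∀ f ∈ ({legendreP ν x, legendreP (ν + 1) x} : Set ℂ),
      ‖f‖ ≤ (A + B) * (1 - x ^ 2) ^ (-ε) := by
    rintro f (rfl | rfl)
    · refine (h1 x hx hx1).trans ?_
      gcongr; linarith
    · refine (h2 x hx hx1).trans ?_
      gcongr; linarith
  have e : (1 - (x : ℂ) ^ 2) = ((1 - x ^ 2 : ℝ) : ℂ) := by push_cast; ring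
  rw [norm_mul, norm_mul, norm_mul, e, Complex.norm_cpow_eq_rpow_re_of_pos hs0]
  calc _ ≤ (((A + B) * (1 - x ^ 2) ^ (-ε)) * ((A + B) * (1 - x ^ 2) ^ (-ε)) *
        ((A + B) * (1 - x ^ 2) ^ (-ε))) * (1 - x ^ 2) ^ a.re := by
        gcongr
        · exact key _ hf₁
        · exact key _ hf₂
        · exact key _ hf₃
    _ = (A + B) ^ 3 * (1 - x ^ 2) ^ (-ε + -ε + -ε + a.re) := by
        rw [Real.rpow_add hs0, Real.rpow_add hs0, Real.rpow_add hs0]; ring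
    _ ≤ _ := by
        gcongr ?_ * ?_
        exact Real.rpow_le_rpow_of_exponent_ge hs0 hs1 (by linarith)

theorem stmt11 (ν : ℂ) (hν : -1 < ν.re) :
    (∫ x in (-1:ℝ)..1, (legendreP ν (x : ℂ)) ^ 3 * ((1 - (x:ℂ) ^ 2) ^ ((ν - 1)/2)))
      = 2 * ∫ x in (-1:ℝ)..1, legendreP ν (x : ℂ) * (legendreP (ν + 1) (x : ℂ)) ^ 2 *
          ((1 - (x:ℂ) ^ 2) ^ ((ν - 1)/2)) := by
  have hν1 : ν + 1 ≠ 0 := by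
    intro h
    have := congrArg Complex.re h
    simp at this
    linarith
  obtain ⟨δ, hδ0, hδ1, hδ⟩ : ∃ δ : ℝ, 0 < δ ∧ δ ≤ 1 ∧ δ ≤ (ν.re + 1) / 2 :=
    ⟨min 1 ((ν.re + 1) / 2), lt_min one_pos (by linarith), min_le_left _ _, min_le_right _ _⟩
  have re1 : ((ν - 1) / 2).re = (ν.re - 1) / 2 := by simp
  have re2 : ((ν + 1) / 2).re = (ν.re + 1) / 2 := by simp
  obtain ⟨K, hK, hb⟩ := triple_bound ν ((ν - 1) / 2) (δ / 6) (-(1 - δ / 2)) (by linarith)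
    (by rw [re1]; linarith)
  obtain ⟨L, hL, hc⟩ := triple_bound ν ((ν + 1) / 2) (δ / 6) (δ / 2) (by linarith)
    (by rw [re2]; linarith)
  have cp := legendreP_cont ν
  have cq := legendreP_cont (ν + 1)
  have cw := weight_cont ((ν - 1) / 2)
  have I1 : IntervalIntegrable (fun x : ℝ => (legendreP ν (x : ℂ)) ^ 3 *
      ((1 - (x:ℂ) ^ 2) ^ ((ν - 1)/2))) volume (-1) 1 := by
    refine integrable_of_bound _ ((cp.pow 3).mul cw) K (1 - δ / 2) hK (by linarith) (by linarith)
      fun x hx hx1 => ?_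
    have := hb x hx hx1 (legendreP ν x) (by simp) (legendreP ν x) (by simp) (legendreP ν x)
      (by simp)
    rwa [show legendreP ν x * legendreP ν x * legendreP ν x = legendreP ν x ^ 3 by ring] at this
  have I2 : IntervalIntegrable (fun x : ℝ => legendreP ν (x : ℂ) *
      (legendreP (ν + 1) (x : ℂ)) ^ 2 * ((1 - (x:ℂ) ^ 2) ^ ((ν - 1)/2))) volume (-1) 1 := by
    refine integrable_of_bound _ ((cp.mul (cq.pow 2)).mul cw) K (1 - δ / 2) hK (by linarith)
      (by linarith) fun x hx hx1 => ?_
    have := hb x hx hx1 (legendreP ν x) (by simp) (legendreP (ν + 1) x) (by simp)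
      (legendreP (ν + 1) x) (by simp)
    rwa [show legendreP ν x * legendreP (ν + 1) x * legendreP (ν + 1) x
      = legendreP ν x * legendreP (ν + 1) x ^ 2 by ring] at this
  have lim : ∀ s : Set ℝ, ∀ c : ℝ, 1 - c ^ 2 = 0 → Set.Ioo (-1) 1 ∈ nhdsWithin c s →
      Filter.Tendsto (fun x : ℝ => legendreP ν (x : ℂ) * legendreP ν (x : ℂ) *
        legendreP (ν + 1) (x : ℂ) * (1 - (x : ℂ) ^ 2) ^ ((ν + 1) / 2)) (nhdsWithin c s)
        (nhds 0) := by
    intro s c hc0 hs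
    have t : Filter.Tendsto (fun x : ℝ => L * (1 - x ^ 2) ^ (δ / 2)) (nhdsWithin c s)
        (nhds 0) := by
      have : ContinuousAt (fun x : ℝ => L * (1 - x ^ 2) ^ (δ / 2)) c := by
        refine continuousAt_const.mul (ContinuousAt.rpow_const (by fun_prop)
          (Or.inr (by linarith)))
      have h := this.tendsto
      simp only [hc0] at h
      rw [Real.zero_rpow (by linarith), mul_zero] at h
      exact h.mono_left nhdsWithin_le_nhds
    refine squeeze_zero_norm' ?_ t
    filter_upwards [hs] with x hx
    exact hc x hx.1 hx.2 _ (by simp) _ (by simp) _ (by simp)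
  have ftc := integral_eq_sub_of_hasDerivAt_of_tendsto (a := (-1 : ℝ)) (b := 1)
    (f := fun x : ℝ => legendreP ν (x : ℂ) * legendreP ν (x : ℂ) *
        legendreP (ν + 1) (x : ℂ) * (1 - (x : ℂ) ^ 2) ^ ((ν + 1) / 2))
    (f' := fun x : ℝ => (ν + 1) * ((legendreP ν (x : ℂ)) ^ 3 * ((1 - (x:ℂ) ^ 2) ^ ((ν - 1)/2))
      - 2 * (legendreP ν (x : ℂ) *
      (legendreP (ν + 1) (x : ℂ)) ^ 2 * ((1 - (x:ℂ) ^ 2) ^ ((ν - 1)/2)))))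
    (by norm_num) ?_ ((I1.sub (I2.const_mul 2)).const_mul _)
    (lim _ (-1) (by norm_num) (Ioo_mem_nhdsGT (by norm_num)))
    (lim _ 1 (by norm_num) (Ioo_mem_nhdsLT (by norm_num)))
  · rw [intervalIntegral.integral_const_mul, intervalIntegral.integral_sub I1 (I2.const_mul 2),
      intervalIntegral.integral_const_mul, sub_zero] at ftc
    exact sub_eq_zero.1 ((mul_eq_zero.1 ftc).resolve_left hν1)
  · intro x hx
    obtain ⟨p', q', hp, hq, e1, e2⟩ := legendreP_deriv ν x hx.1 hx.2
    have hs0 : 0 < 1 - x ^ 2 := by nlinarith [hx.1, hx.2]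
    have e : (1 - (x : ℂ) ^ 2) = ((1 - x ^ 2 : ℝ) : ℂ) := by push_cast; ring
    have hsl : (1 - (x : ℂ) ^ 2) ∈ slitPlane := by
      rw [e]; exact Complex.ofReal_mem_slitPlane.2 hs0
    have hne : (1 - (x : ℂ) ^ 2) ≠ 0 := Complex.slitPlane_ne_zero hsl
    have hw : HasDerivAt (fun y : ℝ => (1 - (y : ℂ) ^ 2) ^ ((ν + 1) / 2))
        ((ν + 1) / 2 * (1 - (x : ℂ) ^ 2) ^ ((ν + 1) / 2 - 1) * (-(2 * x))) x := by
      have h0 : HasDerivAt (fun y : ℂ => 1 - y ^ 2) (-(2 * (x : ℂ))) (x : ℂ) := by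
        simpa using (hasDerivAt_pow 2 (x : ℂ)).const_sub 1
      exact (h0.cpow_const (c := (ν + 1) / 2) hsl).comp_ofReal
    have hexp : (ν + 1) / 2 - 1 = (ν - 1) / 2 := by ring
    have hww : (1 - (x : ℂ) ^ 2) ^ ((ν + 1) / 2)
        = (1 - (x : ℂ) ^ 2) ^ ((ν - 1) / 2) * (1 - (x : ℂ) ^ 2) := by
      rw [show (ν + 1) / 2 = (ν - 1) / 2 + 1 by ring, Complex.cpow_add _ _ hne, Complex.cpow_one]
    rw [hexp] at hw
    have H := ((hp.mul hp).mul hq).mul hw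
    refine H.congr_deriv ?_
    simp only [Pi.mul_apply]
    rw [hww]
    set W := (1 - (x : ℂ) ^ 2) ^ ((ν - 1) / 2)
    set p := legendreP ν (x : ℂ)
    set q := legendreP (ν + 1) (x : ℂ)
    linear_combination (2 * p * q * W) * e1 + (p ^ 2 * W) * e2
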